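/- There exist universal constants c' ≥ c > 0 with c' ≥ 1 such that: for any finite point set X = {x_1,...,x_m} ⊆ X of size m, any hypothesis class H ⊆ {-1,1}^X of VC-dimension d, any 0 < α < 1/2 and any 0 < γ ≤ 1 satisfying γ² ≥ 4·c·d·Ln²(Ln(8·α·m·γ²/(c·d)))/(α²·m), it holds that ln N_∞(X, Δ(H)_⌈γ⌉, α·γ) ≤ (c'·d/(α²·γ²)) · func( 8·α·m·γ²/(c·d) ). -/

import Mathlib

open MeasureTheory
open scoped ENNReal

/-- The truncated natural logarithm `Ln(x) = ln(max(x, e))`. -/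
noncomputable def Ln (x : ℝ) : ℝ := Real.log (max x (Real.exp 1))

/-- `func(x) = Ln(x) · Ln(Ln(x))²`. -/
noncomputable def func (x : ℝ) : ℝ := Ln x * (Ln (Ln x)) ^ 2

/-- The set `Δ(H)` of voting classifiers over `H`: all finite convex combinations
`f = ∑ i, α i • h i` with `h i ∈ H`, `α i > 0` and `∑ i, α i = 1`. -/
def votingClassifiers {X : Type*} (H : Set (X → ℝ)) : Set (X → ℝ) :=
  {f | ∃ (n : ℕ) (a : Fin n → ℝ) (h : Fin n → (X → ℝ)),
    (∀ i, h i ∈ H) ∧ (∀ i, 0 < a i) ∧ (∑ i, a i) = 1 ∧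
    f = fun x => ∑ i, a i * h i x}

/-- `H` realizes all ±1 labelings on the finite point set `s`. -/
def ShattersPM {X : Type*} (H : Set (X → ℝ)) (s : Finset X) : Prop :=
  ∀ b : X → ℝ, (∀ x, b x = 1 ∨ b x = -1) → ∃ h ∈ H, ∀ x ∈ s, h x = b x

/-- `H` has VC-dimension exactly `d`: some set of `d` points is shattered and every
shattered set has at most `d` points. -/
def HasVCDim {X : Type*} (H : Set (X → ℝ)) (d : ℕ) : Prop :=
  (∃ s : Finset X, ShattersPM H s ∧ s.card = d) ∧
    ∀ s : Finset X, ShattersPM H s → s.card ≤ d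

/-- Clipping of `f` at level `γ`. -/
noncomputable def clip {X : Type*} (γ : ℝ) (f : X → ℝ) : X → ℝ :=
  fun x => if γ < f x then γ else if f x < -γ then -γ else f x

/-- The clipped class `F_⌈γ⌉`. -/
def clipClass {X : Type*} (F : Set (X → ℝ)) (γ : ℝ) : Set (X → ℝ) := clip γ '' F

/-- `N` is an `α`-cover of `F` in `ℓ_∞` on the point set `xs`. -/
def IsCoverOn {X : Type*} {m : ℕ} (xs : Fin m → X) (F : Set (X → ℝ)) (α : ℝ)
    (N : Finset (X → ℝ)) : Prop :=
  ∀ f ∈ F, ∃ f' ∈ N, ∀ i, |f (xs i) - f' (xs i)| ≤ α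

/-- The `ℓ_∞` covering number `N_∞(xs, F, α)` (as an extended nonneg. real, `⊤` if no
finite cover exists). -/
noncomputable def coveringNumber {X : Type*} {m : ℕ} (xs : Fin m → X) (F : Set (X → ℝ))
    (α : ℝ) : ℝ≥0∞ :=
  ⨅ (N : Finset (X → ℝ)) (_ : IsCoverOn xs F α N), (N.card : ℝ≥0∞)

/-- `F` β-shatters the points `x` with witness levels `r`. -/
def FatShattersWith {X : Type*} (F : Set (X → ℝ)) (β : ℝ) {n : ℕ}
    (x : Fin n → X) (r : Fin n → ℝ) : Prop :=
  ∀ b : Fin n → Bool, ∃ f ∈ F, ∀ i,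
    (b i = true → r i + β ≤ f (x i)) ∧ (b i = false → f (x i) ≤ r i - β)

/-- `F` β-shatters some set of `n` points. -/
def FatShatters {X : Type*} (F : Set (X → ℝ)) (β : ℝ) (n : ℕ) : Prop :=
  ∃ (x : Fin n → X) (r : Fin n → ℝ), FatShattersWith F β x r

/-- The fat-shattering dimension `fat_β(F)` as an extended natural number. -/
noncomputable def fatDim {X : Type*} (F : Set (X → ℝ)) (β : ℝ) : ℕ∞ :=
  ⨆ (n : ℕ) (_ : FatShatters F β n), (n : ℕ∞)

/-- The γ-margin loss `L_D^γ(f) = Pr_{(x,y)∼D}[y·f(x) ≤ γ]`. -/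
noncomputable def margLossD {X : Type*} [MeasurableSpace X] (μ : Measure (X × ℝ)) (γ : ℝ)
    (f : X → ℝ) : ℝ :=
  (μ {p | p.2 * f p.1 ≤ γ}).toReal

/-- The empirical γ-margin loss `L_S^γ(f)`: the fraction of examples in `S` with margin at
most `γ`. -/
noncomputable def margLossS {X : Type*} {m : ℕ} (S : Fin m → X × ℝ) (γ : ℝ) (f : X → ℝ) : ℝ :=
  (Nat.card {i : Fin m // (S i).2 * f (S i).1 ≤ γ} : ℝ) / m

/-- The empirical θ-margin loss of `f` on the subsequence of `Z` indexed by `s`. -/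
noncomputable def lossIdx {X : Type*} {k : ℕ} (Z : Fin k → X × ℝ) (s : Finset (Fin k))
    (θ : ℝ) (f : X → ℝ) : ℝ :=
  (Nat.card {i : Fin k // i ∈ s ∧ (Z i).2 * f (Z i).1 ≤ θ} : ℝ) / s.card

/-- `L_{D_{c*}}(f) = Pr_{x∼D}[c*(x)·f(x) ≤ 0]`. -/
noncomputable def errD {X : Type*} [MeasurableSpace X] (D : Measure X) (c : X → ℝ)
    (f : X → ℝ) : ℝ :=
  (D {x | c x * f x ≤ 0}).toReal

/-- `maj(f₁,f₂,f₃) = sign(sign f₁ + sign f₂ + sign f₃)`, with `sign 0 = 0`. -/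
noncomputable def majf {X : Type*} (f₁ f₂ f₃ : X → ℝ) : X → ℝ :=
  fun x => Real.sign (Real.sign (f₁ x) + Real.sign (f₂ x) + Real.sign (f₃ x))


section Helpers
open Finset

/-- generating function bound -/
lemma count_bound {ι : Type*} [Fintype ι] [DecidableEq ι] (k : ℕ) (R : ℝ) (hR : 0 < R) (hk : 0 < k)
    (hkm : (k : ℝ) ≤ Fintype.card ι * R) :
    ∑ S ∈ (univ : Finset (Finset ι)).filter (fun S => S.card ≤ k), R ^ S.card
      ≤ (Real.exp 1 * (Fintype.card ι * R / k)) ^ k := by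
  set m : ℝ := (Fintype.card ι : ℝ) with hm
  have hk' : (0 : ℝ) < k := by exact_mod_cast hk
  have hmR : 0 < m * R := lt_of_lt_of_le hk' hkm
  set l : ℝ := k / (m * R) with hl
  have hl0 : 0 < l := by positivity
  have hl1 : l ≤ 1 := by rw [hl, div_le_one hmR]; exact hkm
  have h1 : ∀ S ∈ (univ : Finset (Finset ι)).filter (fun S => S.card ≤ k),
      R ^ S.card ≤ (l⁻¹) ^ k * (R * l) ^ S.card := by
    intro S hS
    simp only [mem_filter, mem_univ, true_and] at hS
    have : (1 : ℝ) ≤ (l⁻¹) ^ k * l ^ S.card := by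
      rw [inv_pow, ← div_eq_inv_mul, le_div_iff₀ (by positivity), one_mul]
      exact pow_le_pow_of_le_one hl0.le hl1 hS
    rw [mul_pow]
    calc R ^ S.card = 1 * R ^ S.card := by ring
      _ ≤ ((l⁻¹) ^ k * l ^ S.card) * R ^ S.card := by gcongr
      _ = _ := by ring
  have h2 : ∑ S : Finset ι, (R * l) ^ S.card = (R * l + 1) ^ Fintype.card ι := by
    have := Finset.sum_pow_mul_eq_add_pow (R * l) 1 (univ : Finset ι)
    simpa using this
  calc _ ≤ ∑ S ∈ (univ : Finset (Finset ι)).filter (fun S => S.card ≤ k),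
            (l⁻¹) ^ k * (R * l) ^ S.card := sum_le_sum h1
    _ ≤ ∑ S : Finset ι, (l⁻¹) ^ k * (R * l) ^ S.card :=
        sum_le_sum_of_subset_of_nonneg (filter_subset _ _) (fun _ _ _ => by positivity)
    _ = (l⁻¹) ^ k * (R * l + 1) ^ Fintype.card ι := by rw [← mul_sum, h2]
    _ ≤ (l⁻¹) ^ k * (Real.exp (R * l)) ^ Fintype.card ι := by
        gcongr
        exact Real.add_one_le_exp _
    _ = (Real.exp 1 * (m * R / k)) ^ k := by
        rw [← Real.exp_nat_mul, mul_pow, ← Real.exp_nat_mul, hl, inv_div, ← hm]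
        have : m * (R * (k / (m * R))) = k * 1 := by
          have : m ≠ 0 := by rintro h; simp [h] at hmR
          field_simp
        rw [this]; ring

/-- trace family -/
noncomputable def trF {X ι : Type*} [Fintype ι] (H : Set (X → ℝ)) (y : ι → X) :
    Finset (Finset ι) :=
  by classical exact univ.filter (fun B => ∃ h ∈ H, ∀ i, i ∈ B ↔ h (y i) = 1)

lemma mem_trF {X ι : Type*} [Fintype ι] (H : Set (X → ℝ)) (y : ι → X) (B : Finset ι) :
    B ∈ trF H y ↔ ∃ h ∈ H, ∀ i, i ∈ B ↔ h (y i) = 1 := by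
  classical
  simp [trF]

lemma trF_shatters {X ι : Type*} [Fintype ι] [DecidableEq ι] (H : Set (X → ℝ)) (y : ι → X)
    (hH : ∀ h ∈ H, ∀ x, h x = 1 ∨ h x = -1) (d : ℕ)
    (hd : ∀ s : Finset X, ShattersPM H s → s.card ≤ d) (S : Finset ι)
    (hS : (trF H y).Shatters S) : S.card ≤ d := by
  classical
  have hinj : Set.InjOn y S := by
    intro i hi j hj hij
    by_contra hne
    obtain ⟨u, hu, hu2⟩ := hS (t := {i}) (by simpa using hi)
    obtain ⟨h, -, hh⟩ := (mem_trF H y u).1 hu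
    have h1 : i ∈ u := by
      have : i ∈ S ∩ u := by rw [hu2]; simp
      exact (mem_inter.1 this).2
    have h2 : j ∈ u := by rw [hh, ← hij, ← hh]; exact h1
    have : j ∈ S ∩ u := mem_inter.2 ⟨hj, h2⟩
    rw [hu2] at this
    exact hne (mem_singleton.1 this).symm
  rw [← card_image_of_injOn hinj]
  apply hd
  intro b hb
  obtain ⟨u, hu, hu2⟩ := hS (t := S.filter (fun i => b (y i) = 1)) (filter_subset _ _)
  obtain ⟨h, hhH, hh⟩ := (mem_trF H y u).1 hu
  refine ⟨h, hhH, ?_⟩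
  intro x hx
  obtain ⟨i, hi, rfl⟩ := mem_image.1 hx
  have key : i ∈ u ↔ b (y i) = 1 := by
    have : i ∈ S ∩ u ↔ i ∈ S.filter (fun i => b (y i) = 1) := by rw [hu2]
    simpa [hi] using this
  rw [hh] at key
  rcases hH h hhH (y i) with h1 | h1 <;> rcases hb (y i) with h2 | h2
  · rw [h1, h2]
  · have := key.1 h1; rw [h1, this]
  · have := key.2 h2; rw [h2, this]
  · rw [h1, h2]

lemma trF_card {X ι : Type*} [Fintype ι] [DecidableEq ι] (H : Set (X → ℝ)) (y : ι → X)
    (hH : ∀ h ∈ H, ∀ x, h x = 1 ∨ h x = -1) (d : ℕ) (hd0 : 0 < d)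
    (hd : ∀ s : Finset X, ShattersPM H s → s.card ≤ d) (hk : d ≤ Fintype.card ι) :
    ((trF H y).card : ℝ) ≤ (Real.exp 1 * (Fintype.card ι / d)) ^ d := by
  have h1 := card_le_card_shatterer (trF H y)
  have h2 : (trF H y).shatterer ⊆ (univ : Finset (Finset ι)).filter (fun S => S.card ≤ d) := by
    intro S hS
    rw [mem_shatterer] at hS
    simpa using trF_shatters H y hH d hd S hS
  have h3 := count_bound (ι := ι) d 1 one_pos hd0 (by simpa using hk)
  have h4 := card_le_card h2
  simp only [one_pow, sum_const, nsmul_eq_mul, mul_one] at h3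
  exact le_trans (by exact_mod_cast h1.trans h4) h3

lemma exp_half_ge (x : ℝ) : x + 1 ≤ 2 * Real.exp (x / 2) := by
  have := Real.add_one_le_exp (x/2); linarith

/-- weak packing bound -/
lemma packing {X ι : Type*} [Fintype ι] [DecidableEq ι] (H : Set (X → ℝ)) (y : ι → X)
    (hH : ∀ h ∈ H, ∀ x, h x = 1 ∨ h x = -1) (d : ℕ) (hd0 : 0 < d)
    (hd : ∀ s : Finset X, ShattersPM H s → s.card ≤ d)
    (P : Finset (Finset ι)) (hP : P ⊆ trF H y) (η : ℝ) (h0 : 0 < η) (h1 : η ≤ 1)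
    (hn : 0 < Fintype.card ι)
    (hsep : ∀ B ∈ P, ∀ B' ∈ P, B ≠ B' → η * Fintype.card ι < ((symmDiff B B').card : ℝ)) :
    (P.card : ℝ) ≤ (11 / η) ^ (2 * d) := by
  classical
  rcases Nat.eq_zero_or_pos P.card with hP0 | hP0
  · rw [hP0]; simp; positivity
  obtain ⟨N, hN⟩ : ∃ N : ℝ, N = (P.card : ℝ) := ⟨_, rfl⟩
  rw [← hN]
  have hN1 : 1 ≤ N := by rw [hN]; exact_mod_cast hP0
  have hdR : (1:ℝ) ≤ d := by exact_mod_cast hd0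
  set x : ℝ := Real.log N / d with hx
  have hx0 : 0 ≤ x := div_nonneg (Real.log_nonneg hN1) (by linarith)
  have hNx : N = Real.exp (d * x) := by
    rw [hx, mul_div_cancel₀ _ (by linarith : (d:ℝ) ≠ 0), Real.exp_log (by linarith)]
  set k : ℕ := ⌊2 * (d * x) / η⌋₊ + d with hk
  have hk1 : 2 * (d * x) < η * k := by
    have := Nat.lt_floor_add_one (2 * (d * x) / η)
    have h2 : 2 * (d * x) / η < k := by rw [hk]; push_cast; linarith
    rw [div_lt_iff₀ h0] at h2; linarith
  have hk2 : (k : ℝ) ≤ d * (2 * x / η + 1) := by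
    have := Nat.floor_le (a := 2 * (d * x) / η) (by positivity)
    rw [hk]; push_cast
    have e : d * (2 * x / η + 1) = 2 * (d * x) / η + d := by ring
    linarith
  -- existence of a separating sequence
  have hex : ∃ t : Fin k → ι, ∀ B ∈ P, ∀ B' ∈ P, B ≠ B' → ∃ a, t a ∈ symmDiff B B' := by
    by_contra hcon
    push Not at hcon
    have hcov : (univ : Finset (Fin k → ι)) ⊆ (P ×ˢ P).biUnion (fun p =>
        if p.1 = p.2 then ∅ else Fintype.piFinset (fun _ : Fin k => (symmDiff p.1 p.2)ᶜ)) := by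
      intro t _
      obtain ⟨B, hB, B', hB', hne, ht⟩ := hcon t
      rw [mem_biUnion]
      refine ⟨(B, B'), by simp [hB, hB'], ?_⟩
      simp only [hne, if_false, Fintype.mem_piFinset, mem_compl]
      exact ht
    have hc := (card_le_card hcov).trans card_biUnion_le
    have hterm : ∀ p ∈ P ×ˢ P, (((if p.1 = p.2 then (∅ : Finset (Fin k → ι)) else
        Fintype.piFinset (fun _ : Fin k => (symmDiff p.1 p.2)ᶜ)).card : ℕ) : ℝ)
        ≤ (Fintype.card ι : ℝ) ^ k * Real.exp (-(η * k)) := by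
      intro p hp
      split_ifs with hpp
      · simp; positivity
      · rw [Fintype.card_piFinset, prod_const, card_univ, Fintype.card_fin, card_compl]
        have hs := hsep p.1 (mem_product.1 hp).1 p.2 (mem_product.1 hp).2 hpp
        rw [Nat.cast_pow, Nat.cast_sub (card_le_univ _)]
        have e1 : (Fintype.card ι : ℝ) - (symmDiff p.1 p.2).card
            ≤ Fintype.card ι * Real.exp (-η) := by
          have := Real.add_one_le_exp (-η)
          have hc0 : (0:ℝ) ≤ Fintype.card ι := by positivity
          nlinarith
        have e0 : (0:ℝ) ≤ (Fintype.card ι : ℝ) - (symmDiff p.1 p.2).card := by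
          have : (symmDiff p.1 p.2).card ≤ Fintype.card ι := card_le_univ _
          have : ((symmDiff p.1 p.2).card : ℝ) ≤ Fintype.card ι := by exact_mod_cast this
          linarith
        calc _ ≤ (Fintype.card ι * Real.exp (-η)) ^ k := pow_le_pow_left₀ e0 e1 k
          _ = _ := by rw [mul_pow, ← Real.exp_nat_mul]; congr 2; ring
    have hc' : ((Fintype.card (Fin k → ι) : ℕ) : ℝ) ≤
        ∑ p ∈ P ×ˢ P, (Fintype.card ι : ℝ) ^ k * Real.exp (-(η * k)) := by
      refine le_trans ?_ (sum_le_sum hterm)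
      rw [← Nat.cast_sum]
      exact_mod_cast hc
    rw [sum_const, card_product, nsmul_eq_mul, Fintype.card_fun, Fintype.card_fin] at hc'
    push_cast at hc'
    have hpos : (0:ℝ) < (Fintype.card ι : ℝ) ^ k := by
      have : (0:ℝ) < Fintype.card ι := by exact_mod_cast hn
      positivity
    have : N * N * Real.exp (-(η * k)) < 1 := by
      rw [hNx, ← Real.exp_add, ← Real.exp_add, Real.exp_lt_one_iff]
      linarith
    rw [← hN] at hc'
    nlinarith
  obtain ⟨t, ht⟩ := hex
  have hcard : P.card ≤ (trF H (y ∘ t)).card := by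
    apply card_le_card_of_injOn (fun B => univ.filter (fun a => t a ∈ B))
    · intro B hB
      obtain ⟨h, hh, hh2⟩ := (mem_trF H y B).1 (hP hB)
      rw [mem_coe, mem_trF]
      exact ⟨h, hh, fun i => by simp [hh2]⟩
    · intro B hB B' hB' he
      by_contra hne
      obtain ⟨a, ha⟩ := ht B hB B' hB' hne
      have : a ∈ univ.filter (fun a => t a ∈ B) ↔ a ∈ univ.filter (fun a => t a ∈ B') := by
        have he' : univ.filter (fun a => t a ∈ B) = univ.filter (fun a => t a ∈ B') := he
        rw [he']
      simp only [mem_filter, mem_univ, true_and] at this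
      rw [mem_symmDiff] at ha
      tauto
  have hS := trF_card H (y ∘ t) hH d hd0 hd (by simp [hk])
  rw [Fintype.card_fin] at hS
  have hcR : N ≤ (Real.exp 1 * (k / d)) ^ d := le_trans (by rw [hN]; exact_mod_cast hcard) hS
  have hkd : (k : ℝ) / d ≤ 2 * (x + 1) / η := by
    rw [div_le_iff₀ (by linarith)]
    refine hk2.trans ?_
    have : 2 * x / η + 1 ≤ 2 * (x + 1) / η := by
      have h3 : 1 ≤ 2 / η := by rw [le_div_iff₀ h0]; linarith
      have : 2 * (x + 1) / η = 2 * x / η + 2 / η := by ring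
      linarith
    nlinarith
  have hex1 : Real.exp x ≤ Real.exp 1 * (2 * (x + 1) / η) := by
    have hh : (Real.exp x) ^ d ≤ (Real.exp 1 * (2 * (x + 1) / η)) ^ d := by
      rw [← Real.exp_nat_mul, ← hNx]
      refine hcR.trans ?_
      gcongr
    exact le_of_pow_le_pow_left₀ (by omega) (by positivity) hh
  have hex2 : Real.exp (x / 2) ≤ 11 / η := by
    have e1 : Real.exp x = Real.exp (x/2) * Real.exp (x/2) := by rw [← Real.exp_add]; ring_nf
    have e2 := exp_half_ge x
    have e3 : Real.exp (x/2) * Real.exp (x/2) ≤ Real.exp (x/2) * (Real.exp 1 * 4 / η) := by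
      rw [← e1]
      refine hex1.trans ?_
      have : Real.exp 1 * (2 * (x + 1) / η) = (x + 1) * (Real.exp 1 * 2 / η) := by ring
      rw [this]
      calc _ ≤ (2 * Real.exp (x/2)) * (Real.exp 1 * 2 / η) := by gcongr
        _ = _ := by ring
    have e4 := le_of_mul_le_mul_left e3 (Real.exp_pos _)
    refine e4.trans ?_
    have := Real.exp_one_lt_d9
    gcongr
    linarith
  calc N = (Real.exp (x/2)) ^ (2 * d) := by
        rw [hNx, ← Real.exp_nat_mul]; congr 1; push_cast; ring
    _ ≤ _ := by gcongr

end Helpers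

section Helpers2
open Finset

/-- sign of a boolean -/
def sgb (b : Bool) : ℝ := if b then 1 else -1

lemma sgb_not (b : Bool) : sgb (!b) = - sgb b := by cases b <;> simp [sgb]

lemma mgf_sign {ι : Type*} [Fintype ι] [DecidableEq ι] (v : ι → ℝ) (l : ℝ) :
    ∑ s : ι → Bool, Real.exp (l * ∑ i, sgb (s i) * v i)
      ≤ 2 ^ Fintype.card ι * Real.exp (l ^ 2 * (∑ i, v i ^ 2) / 2) := by
  have h1 : ∑ s : ι → Bool, Real.exp (l * ∑ i, sgb (s i) * v i)
      = ∏ i, ∑ b : Bool, Real.exp (l * (sgb b * v i)) := by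
    rw [Finset.prod_univ_sum]
    rw [Fintype.piFinset_univ]
    apply sum_congr rfl
    intro s _
    rw [mul_sum, Real.exp_sum]
  rw [h1]
  have h2 : ∀ i, ∑ b : Bool, Real.exp (l * (sgb b * v i)) ≤ 2 * Real.exp (l ^ 2 * v i ^ 2 / 2) := by
    intro i
    have := Real.cosh_le_exp_half_sq (l * v i)
    rw [Real.cosh_eq] at this
    simp only [Fintype.sum_bool, sgb]
    simp only [if_true, one_mul, Bool.false_eq_true, if_false, neg_mul, mul_neg]
    rw [mul_pow] at this
    linarith
  calc _ ≤ ∏ i : ι, 2 * Real.exp (l ^ 2 * v i ^ 2 / 2) :=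
        prod_le_prod (fun i _ => sum_nonneg (fun _ _ => (Real.exp_pos _).le)) (fun i _ => h2 i)
    _ = _ := by
        rw [prod_mul_distrib, prod_const, card_univ, ← Real.exp_sum, mul_sum, sum_div]

lemma tail_sign {ι : Type*} [Fintype ι] [DecidableEq ι] (v : ι → ℝ) (R t : ℝ) (hR : 0 < R)
    (ht : 0 < t) (hv : ∑ i, v i ^ 2 ≤ R) :
    (((univ : Finset (ι → Bool)).filter (fun s => t ≤ ∑ i, sgb (s i) * v i)).card : ℝ)
      ≤ 2 ^ Fintype.card ι * Real.exp (- (t ^ 2 / (2 * R))) := by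
  have h := mgf_sign v (t / R)
  have h1 : (((univ : Finset (ι → Bool)).filter (fun s => t ≤ ∑ i, sgb (s i) * v i)).card : ℝ)
      * Real.exp (t / R * t) ≤ ∑ s : ι → Bool, Real.exp (t / R * ∑ i, sgb (s i) * v i) := by
    rw [← nsmul_eq_mul, ← sum_const]
    calc _ ≤ ∑ s ∈ (univ : Finset (ι → Bool)).filter (fun s => t ≤ ∑ i, sgb (s i) * v i),
          Real.exp (t / R * ∑ i, sgb (s i) * v i) := by
          apply sum_le_sum
          intro s hs
          simp only [mem_filter, mem_univ, true_and] at hs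
          gcongr
      _ ≤ _ := sum_le_sum_of_subset_of_nonneg (filter_subset _ _)
            (fun _ _ _ => (Real.exp_pos _).le)
  have h2 : Real.exp ((t / R) ^ 2 * (∑ i, v i ^ 2) / 2) ≤ Real.exp (t ^ 2 / (2 * R)) := by
    rw [Real.exp_le_exp]
    calc (t / R) ^ 2 * (∑ i, v i ^ 2) / 2 ≤ (t / R) ^ 2 * R / 2 := by gcongr
      _ = _ := by field_simp
  have h3 : Real.exp (-(t ^ 2 / (2 * R))) * Real.exp (t / R * t) = Real.exp (t ^ 2 / (2 * R)) := by
    rw [← Real.exp_add]; congr 1; field_simp; ring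
  have h4 := h1.trans (h.trans (mul_le_mul_of_nonneg_left h2 (by positivity)))
  rw [← h3, ← mul_assoc] at h4
  exact le_of_mul_le_mul_right h4 (Real.exp_pos _)

lemma exists_sign {ι : Type*} [Fintype ι] [DecidableEq ι] (J : ℕ) (P : ℕ → Finset (ι → ℝ))
    (R t : ℕ → ℝ) (hR : ∀ j, 0 < R j) (ht : ∀ j, 0 < t j)
    (hv : ∀ j, ∀ v ∈ P j, ∑ i, v i ^ 2 ≤ R j)
    (hsum : ∑ j ∈ range J, ((P j).card : ℝ) * (2 * Real.exp (- (t j ^ 2 / (2 * R j)))) < 1) :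
    ∃ s : ι → Bool, ∀ j < J, ∀ v ∈ P j, |∑ i, sgb (s i) * v i| < t j := by
  classical
  by_contra hcon
  push Not at hcon
  set E : (ι → ℝ) → ℝ → Finset (ι → Bool) := fun v t =>
    (univ : Finset (ι → Bool)).filter (fun s => t ≤ ∑ i, sgb (s i) * v i) with hE
  have hcov : (univ : Finset (ι → Bool)) ⊆ (range J).biUnion (fun j =>
      (P j).biUnion (fun v => E v (t j) ∪ E (-v) (t j))) := by
    intro s _
    obtain ⟨j, hj, v, hvP, hs⟩ := hcon s
    simp only [mem_biUnion, mem_range]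
    refine ⟨j, hj, v, hvP, ?_⟩
    rcases le_abs.1 hs with h | h
    · apply mem_union_left; simp [hE, h]
    · apply mem_union_right
      simpa [hE] using h
  have h1 := (card_le_card hcov).trans card_biUnion_le
  have h2 : ∀ j ∈ range J, ((((P j).biUnion (fun v => E v (t j) ∪ E (-v) (t j))).card : ℕ) : ℝ)
      ≤ 2 ^ Fintype.card ι * (((P j).card : ℝ) * (2 * Real.exp (- (t j ^ 2 / (2 * R j))))) := by
    intro j _
    have h3 : ((((P j).biUnion (fun v => E v (t j) ∪ E (-v) (t j))).card : ℕ) : ℝ)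
        ≤ ∑ v ∈ P j, (((E v (t j) ∪ E (-v) (t j)).card : ℕ) : ℝ) := by
      rw [← Nat.cast_sum]; exact_mod_cast card_biUnion_le
    refine h3.trans ?_
    have h4 : ∀ v ∈ P j, (((E v (t j) ∪ E (-v) (t j)).card : ℕ) : ℝ) ≤
        2 ^ Fintype.card ι * (2 * Real.exp (- (t j ^ 2 / (2 * R j)))) := by
      intro v hvP
      have a1 := tail_sign v (R j) (t j) (hR j) (ht j) (hv j v hvP)
      have a2 := tail_sign (-v) (R j) (t j) (hR j) (ht j) (by simpa using hv j v hvP)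
      have a3 : (((E v (t j) ∪ E (-v) (t j)).card : ℕ) : ℝ) ≤ (E v (t j)).card + (E (-v) (t j)).card := by
        exact_mod_cast card_union_le _ _
      have a1' : ((E v (t j)).card : ℝ) ≤ _ := a1
      have a2' : ((E (-v) (t j)).card : ℝ) ≤ _ := a2
      linarith
    refine (sum_le_sum h4).trans (le_of_eq ?_)
    rw [sum_const, nsmul_eq_mul]; ring
  have h5 : ((2 ^ Fintype.card ι : ℕ) : ℝ) ≤ ∑ j ∈ range J,
      2 ^ Fintype.card ι * (((P j).card : ℝ) * (2 * Real.exp (- (t j ^ 2 / (2 * R j))))) := by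
    refine le_trans ?_ (sum_le_sum h2)
    rw [← Nat.cast_sum]
    have : Fintype.card (ι → Bool) = 2 ^ Fintype.card ι := by simp
    rw [← this]
    exact_mod_cast h1
  rw [← mul_sum] at h5
  push_cast at h5
  have : (0:ℝ) < 2 ^ Fintype.card ι := by positivity
  nlinarith

/-- maximal separated subset -/
lemma exists_net {β : Type*} [DecidableEq β] (F : Finset β) (far : β → β → Prop)
    (hsymm : ∀ a b, far a b → far b a) :
    ∃ P ⊆ F, (∀ a ∈ P, ∀ b ∈ P, a ≠ b → far a b) ∧ ∀ a ∈ F, ∃ b ∈ P, a = b ∨ ¬ far a b := by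
  classical
  set U := F.powerset.filter (fun P => ∀ a ∈ P, ∀ b ∈ P, a ≠ b → far a b) with hU
  have hne : U.Nonempty := ⟨∅, by simp [hU]⟩
  obtain ⟨P, hP, hmax⟩ := exists_max_image U card hne
  simp only [hU, mem_filter, mem_powerset] at hP
  refine ⟨P, hP.1, hP.2, ?_⟩
  intro a ha
  by_contra hcon
  push Not at hcon
  have haP : a ∉ P := fun h => (hcon a h).1 rfl
  have : insert a P ∈ U := by
    simp only [hU, mem_filter, mem_powerset]
    refine ⟨insert_subset ha hP.1, ?_⟩
    intro x hx z hz hxz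
    rcases mem_insert.1 hx with h1 | h1 <;> rcases mem_insert.1 hz with h2 | h2
    · exact absurd (h1.trans h2.symm) hxz
    · rw [h1]; exact (hcon z h2).2
    · rw [h2]; exact hsymm _ _ (hcon x h1).2
    · exact hP.2 x h1 z h2 hxz
  have := hmax _ this
  rw [card_insert_of_notMem haP] at this
  omega

end Helpers2

section Helpers3
open Finset

/-- signed indicator -/
noncomputable def chi {ι : Type*} (B : Finset ι) (i : ι) : ℝ := by
  classical exact if i ∈ B then 1 else -1

lemma chi_diff_sq {ι : Type*} [Fintype ι] [DecidableEq ι] (B B' : Finset ι) :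
    ∑ i, (chi B i - chi B' i) ^ 2 = 4 * ((symmDiff B B').card : ℝ) := by
  have h : ∀ i, (chi B i - chi B' i) ^ 2 = if i ∈ symmDiff B B' then 4 else 0 := by
    intro i
    by_cases h1 : i ∈ B <;> by_cases h2 : i ∈ B' <;> simp [chi, h1, h2, mem_symmDiff] <;> norm_num
  simp_rw [h]
  rw [sum_ite_mem, univ_inter, sum_const, nsmul_eq_mul]; ring

lemma chi_sq {ι : Type*} [Fintype ι] (B : Finset ι) :
    ∑ i, (chi B i) ^ 2 = (Fintype.card ι : ℝ) := by
  have h : ∀ i, (chi B i) ^ 2 = 1 := by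
    intro i
    by_cases h1 : i ∈ B <;> simp [chi, h1]
  simp_rw [h]; simp

lemma symmDiff_tri {ι : Type*} [DecidableEq ι] (A B C : Finset ι) :
    (symmDiff B C).card ≤ (symmDiff A B).card + (symmDiff A C).card := by
  refine (card_le_card ?_).trans (card_union_le _ _)
  intro x
  simp only [mem_union, mem_symmDiff]
  tauto

lemma term_bound (d j : ℕ) (hd : 0 < d) (e : ℝ) (he : 20 * d * (1.62 : ℝ) ^ j ≤ e) :
    ((11 * 2 ^ j : ℝ) ^ (2 * d) * (11 * 2 ^ j) ^ (2 * d)) * (2 * Real.exp (-e))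
      ≤ (1 / 4) * (1 / 2) ^ j := by
  have h1 : (11 : ℝ) ≤ Real.exp 3 := by
    have := Real.exp_one_gt_d9
    have e3 : Real.exp 3 = Real.exp 1 ^ 3 := by rw [← Real.exp_nat_mul]; norm_num
    rw [e3]
    calc (11:ℝ) ≤ 2.7 ^ 3 := by norm_num
      _ ≤ _ := by gcongr; linarith
  have h2 : (2 : ℝ) ≤ Real.exp 1 := by have := Real.exp_one_gt_d9; linarith
  have h3 : (11 * 2 ^ j : ℝ) ≤ Real.exp (3 + j) := by
    rw [Real.exp_add]
    have : Real.exp (j:ℝ) = Real.exp 1 ^ j := by rw [← Real.exp_nat_mul, mul_one]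
    rw [this]
    gcongr
  have h4 : ((11 * 2 ^ j : ℝ) ^ (2 * d) * (11 * 2 ^ j) ^ (2 * d)) ≤ Real.exp (d * (12 + 4 * j)) := by
    rw [← pow_add]
    calc _ ≤ (Real.exp (3 + j)) ^ (2 * d + 2 * d) := by gcongr
      _ = _ := by rw [← Real.exp_nat_mul]; congr 1; push_cast; ring
  have h5 : (1 : ℝ) + j * 0.62 ≤ 1.62 ^ j := by
    have := one_add_mul_le_pow (a := (0.62:ℝ)) (by norm_num) j
    norm_num at this ⊢
    linarith
  have hdR : (1 : ℝ) ≤ d := by exact_mod_cast hd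
  have hj0 : (0:ℝ) ≤ j := by positivity
  have h6 : (d : ℝ) * (20 + 12 * j) ≤ e := by
    refine le_trans ?_ he
    nlinarith
  have h7 : Real.exp (d * (12 + 4 * j)) * (2 * Real.exp (-e)) ≤ 2 * Real.exp (-(8 + j)) := by
    have : Real.exp (d * (12 + 4 * j)) * (2 * Real.exp (-e)) = 2 * Real.exp (d * (12 + 4 * j) - e) := by
      rw [sub_eq_add_neg, Real.exp_add]; ring
    rw [this]
    gcongr
    nlinarith
  refine (mul_le_mul_of_nonneg_right h4 (by positivity)).trans (h7.trans ?_)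
  rw [neg_add, Real.exp_add]
  have h8 : Real.exp (-8) ≤ 1 / 8 := by
    rw [Real.exp_neg, inv_le_comm₀ (Real.exp_pos _) (by norm_num)]
    have := Real.add_one_le_exp (8:ℝ)
    norm_num; linarith
  have h9 : Real.exp (-(j:ℝ)) ≤ (1 / 2) ^ j := by
    rw [Real.exp_neg, one_div, inv_pow]
    gcongr
    have : Real.exp (j:ℝ) = Real.exp 1 ^ j := by rw [← Real.exp_nat_mul, mul_one]
    rw [this]; gcongr
  have := Real.exp_pos (-(j:ℝ))
  have := Real.exp_pos (-8:ℝ)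
  calc 2 * (Real.exp (-8) * Real.exp (-(j:ℝ))) ≤ 2 * ((1/8) * (1 / 2) ^ j) := by gcongr
    _ = _ := by ring

lemma chain_bound {X ι : Type*} [Fintype ι] [DecidableEq ι] (H : Set (X → ℝ)) (y : ι → X)
    (hH : ∀ h ∈ H, ∀ x, h x = 1 ∨ h x = -1) (d : ℕ) (hd0 : 0 < d)
    (hd : ∀ s : Finset X, ShattersPM H s → s.card ≤ d) (hn : 0 < Fintype.card ι) :
    ∃ s : ι → Bool, ∀ B ∈ trF H y,
      |∑ i, sgb (s i) * chi B i| ≤ 220 * Real.sqrt (Fintype.card ι * d) := by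
  classical
  set n : ℝ := (Fintype.card ι : ℝ) with hnn
  have hn0 : 0 < n := by rw [hnn]; exact_mod_cast hn
  have hdR : (0:ℝ) < d := by exact_mod_cast hd0
  -- nets
  have hnet : ∀ j : ℕ, ∃ π : Finset ι → Finset ι,
      (((trF H y).image π).card : ℝ) ≤ (11 * 2 ^ j) ^ (2 * d) ∧
      ∀ B ∈ trF H y, ((symmDiff B (π B)).card : ℝ) ≤ (1 / 2) ^ j * n := by
    intro j
    obtain ⟨P, hPF, hsep, hcov⟩ := exists_net (trF H y)
      (fun B B' => (1 / 2 : ℝ) ^ j * n < ((symmDiff B B').card : ℝ))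
      (fun a b h => by rwa [symmDiff_comm] )
    choose! π hπ using hcov
    refine ⟨π, ?_, ?_⟩
    · have h1 : (trF H y).image π ⊆ P := by
        intro B hB
        obtain ⟨B', hB', rfl⟩ := mem_image.1 hB
        exact (hπ B' hB').1
      have h2 := packing H y hH d hd0 hd P hPF ((1/2) ^ j) (by positivity)
        (pow_le_one₀ (by norm_num) (by norm_num)) hn hsep
      refine le_trans (by exact_mod_cast card_le_card h1) (h2.trans (le_of_eq ?_))
      congr 1
      rw [one_div, inv_pow, div_inv_eq_mul]
    · intro B hB
      rcases (hπ B hB).2 with h | h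
      · rw [← h]; simp; positivity
      · exact not_lt.1 h
  choose π hπ1 hπ2 using hnet
  set g : ℕ → Finset ι → ι → ℝ := fun j B => Nat.casesOn j 0 (fun j' => chi (π j' B)) with hg
  have g0 : ∀ B, g 0 B = 0 := fun B => rfl
  have gs : ∀ j B, g (j + 1) B = chi (π j B) := fun j B => rfl
  have gcard_s : ∀ j, (((trF H y).image (g (j+1))).card : ℝ) ≤ (11 * 2 ^ j) ^ (2 * d) := by
    intro j
    have : (trF H y).image (g (j+1)) = ((trF H y).image (π j)).image chi := by
      rw [image_image]; rfl
    rw [this]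
    exact le_trans (by exact_mod_cast card_image_le) (hπ1 j)
  have gcard : ∀ j, (((trF H y).image (g j)).card : ℝ) ≤ (11 * 2 ^ j) ^ (2 * d) := by
    intro j
    cases j with
    | zero =>
      have h1 : (trF H y).image (g 0) ⊆ {0} := by
        intro v hv
        obtain ⟨B, -, rfl⟩ := mem_image.1 hv
        simp [g0]
      have h2 := card_le_card h1
      rw [card_singleton] at h2
      have h3 : (((trF H y).image (g 0)).card : ℝ) ≤ 1 := by exact_mod_cast h2
      refine h3.trans (one_le_pow₀ (by norm_num))
    | succ j =>
      refine (gcard_s j).trans ?_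
      gcongr
      · norm_num
      · omega
  set P : ℕ → Finset (ι → ℝ) := fun j => (trF H y).image (fun B => g (j+1) B - g j B) with hP
  have hPc : ∀ j, ((P j).card : ℝ) ≤ (11 * 2 ^ j) ^ (2 * d) * (11 * 2 ^ j) ^ (2 * d) := by
    intro j
    have h1 : P j ⊆ image₂ (fun u v => u - v) ((trF H y).image (g (j+1))) ((trF H y).image (g j)) := by
      intro v hv
      obtain ⟨B, hB, rfl⟩ := mem_image.1 hv
      exact mem_image₂.2 ⟨_, mem_image_of_mem _ hB, _, mem_image_of_mem _ hB, rfl⟩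
    have h2 := (card_le_card h1).trans (card_image₂_le _ _ _)
    calc ((P j).card : ℝ) ≤ (((trF H y).image (g (j+1))).card : ℝ) * (((trF H y).image (g j)).card : ℝ) := by
          exact_mod_cast h2
      _ ≤ _ := by gcongr; exacts [gcard_s j, gcard j]
  have hR : ∀ j, ∀ v ∈ P j, ∑ i, v i ^ 2 ≤ 12 * (1 / 2) ^ j * n := by
    intro j v hv
    obtain ⟨B, hB, rfl⟩ := mem_image.1 hv
    cases j with
    | zero =>
      simp only [gs, g0, sub_zero]
      rw [chi_sq]
      simp only [pow_zero, ← hnn]; linarith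
    | succ j =>
      simp only [gs, Pi.sub_apply]
      rw [chi_diff_sq]
      have h1 := symmDiff_tri B (π (j+1) B) (π j B)
      have h1' : ((symmDiff (π (j+1) B) (π j B)).card : ℝ) ≤
        (symmDiff B (π (j+1) B)).card + (symmDiff B (π j B)).card := by exact_mod_cast h1
      have h2 := hπ2 (j+1) B hB
      have h3 := hπ2 j B hB
      rw [pow_succ] at h2 ⊢
      linarith
  set q : ℝ := Real.sqrt (n * d) with hq
  have hq0 : 0 < q := Real.sqrt_pos.2 (by positivity)
  have hq2 : q ^ 2 = n * d := Real.sq_sqrt (by positivity)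
  set J : ℕ := Fintype.card ι + 1 with hJ
  obtain ⟨s, hs⟩ := exists_sign J P (fun j => 12 * (1 / 2) ^ j * n) (fun j => 22 * (9/10) ^ j * q)
    (fun j => by positivity) (fun j => by positivity) hR (by
      have hterm : ∀ j ∈ range J, ((P j).card : ℝ) *
          (2 * Real.exp (- ((22 * (9/10) ^ j * q) ^ 2 / (2 * (12 * (1 / 2) ^ j * n)))))
          ≤ (1 / 4) * (1 / 2) ^ j := by
        intro j _
        refine (mul_le_mul_of_nonneg_right (hPc j) (by positivity)).trans ?_
        apply term_bound d j hd0
        have e1 : (22 * (9/10) ^ j * q) ^ 2 / (2 * (12 * (1 / 2) ^ j * n))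
            = 484 / 24 * d * ((9/10) ^ 2 * 2) ^ j := by
          rw [mul_pow, hq2, mul_pow, mul_pow ((9/10 : ℝ)^2), ← pow_mul, ← pow_mul, mul_comm j 2,
            one_div, inv_pow]
          field_simp
          norm_num
        rw [e1]
        have e2 : ((9/10 : ℝ) ^ 2 * 2) = 1.62 := by norm_num
        rw [e2]
        gcongr
        norm_num
      refine lt_of_le_of_lt (sum_le_sum hterm) ?_
      rw [← mul_sum]
      have := sum_geometric_two_le J
      linarith)
  refine ⟨s, ?_⟩
  intro B hB
  have hlast : π (Fintype.card ι) B = B := by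
    have h1 := hπ2 (Fintype.card ι) B hB
    have h2 : (1 / 2 : ℝ) ^ (Fintype.card ι) * n < 1 := by
      rw [one_div, inv_pow, ← div_eq_inv_mul, div_lt_one (by positivity)]
      rw [hnn]; exact_mod_cast Nat.lt_two_pow_self
    have h3 : ((symmDiff B (π (Fintype.card ι) B)).card : ℝ) < 1 := lt_of_le_of_lt h1 h2
    have h4 : (symmDiff B (π (Fintype.card ι) B)).card = 0 := by
      have : (symmDiff B (π (Fintype.card ι) B)).card < 1 := by exact_mod_cast h3
      omega
    rw [card_eq_zero] at h4
    exact (symmDiff_eq_bot.1 h4).symm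
  have htel : ∀ i, chi B i = ∑ j ∈ range J, (g (j+1) B - g j B) i := by
    intro i
    have h1 := sum_range_sub (fun j => g j B i) J
    simp only [Pi.sub_apply]
    rw [h1, g0, hJ, gs, hlast]; simp
  have h1 : ∑ i, sgb (s i) * chi B i = ∑ j ∈ range J, ∑ i, sgb (s i) * (g (j+1) B - g j B) i := by
    rw [sum_comm]
    apply sum_congr rfl
    intro i _
    rw [htel i, mul_sum]
  rw [h1]
  calc _ ≤ ∑ j ∈ range J, |∑ i, sgb (s i) * (g (j+1) B - g j B) i| := abs_sum_le_sum_abs _ _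
    _ ≤ ∑ j ∈ range J, 22 * (9/10) ^ j * q := by
        apply sum_le_sum
        intro j hj
        exact (hs j (mem_range.1 hj) _ (mem_image_of_mem _ hB)).le
    _ = (22 * q) * ∑ j ∈ range J, (9/10 : ℝ) ^ j := by
        rw [mul_sum]; apply sum_congr rfl; intro j _; ring
    _ ≤ (22 * q) * 10 := by
        gcongr
        rw [geom_sum_eq (by norm_num)]
        have : (0:ℝ) < (9/10) ^ J := by positivity
        rw [div_le_iff_of_neg (by norm_num)]
        linarith
    _ = _ := by ring

/-- fat-shattering bound for voting classifiers -/
lemma fat_bound {X ι : Type*} [Fintype ι] [DecidableEq ι] (H : Set (X → ℝ)) (y : ι → X)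
    (hH : ∀ h ∈ H, ∀ x, h x = 1 ∨ h x = -1) (d : ℕ) (hd0 : 0 < d)
    (hd : ∀ s : Finset X, ShattersPM H s → s.card ≤ d) (r : ι → ℝ) (β : ℝ) (hβ : 0 < β)
    (hsh : ∀ b : ι → Bool, ∃ f ∈ votingClassifiers H, ∀ i,
      (b i = true → r i + β ≤ f (y i)) ∧ (b i = false → f (y i) ≤ r i - β)) :
    (Fintype.card ι : ℝ) ≤ 48400 * d / β ^ 2 := by
  classical
  rcases Nat.eq_zero_or_pos (Fintype.card ι) with hn | hn
  · rw [hn]; simp; positivity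
  have hn0 : (0:ℝ) < Fintype.card ι := by exact_mod_cast hn
  obtain ⟨s, hs⟩ : ∃ s : ι → Bool, (∀ B ∈ trF H y,
      |∑ i, sgb (s i) * chi B i| ≤ 220 * Real.sqrt (Fintype.card ι * d)) ∧
      0 ≤ ∑ i, sgb (s i) * r i := by
    obtain ⟨s, hs⟩ := chain_bound H y hH d hd0 hd hn
    rcases le_total 0 (∑ i, sgb (s i) * r i) with h | h
    · exact ⟨s, hs, h⟩
    · refine ⟨fun i => !(s i), ?_, ?_⟩
      · intro B hB
        simp only [sgb_not, neg_mul, sum_neg_distrib, abs_neg]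
        exact hs B hB
      · simp only [sgb_not, neg_mul, sum_neg_distrib]; linarith
  obtain ⟨hs1, hs2⟩ := hs
  obtain ⟨f, ⟨k, a, h, hhH, ha, hasum, rfl⟩, hf⟩ := hsh s
  have low : Fintype.card ι * β ≤ ∑ i, sgb (s i) * (∑ k, a k * h k (y i)) := by
    have : ∑ i : ι, (sgb (s i) * r i + β) ≤ ∑ i, sgb (s i) * (∑ k, a k * h k (y i)) := by
      apply sum_le_sum
      intro i _
      have := hf i
      cases hsi : s i
      · have := this.2 hsi; simp only [sgb]; simp; linarith
      · have := this.1 hsi; simp only [sgb]; simp; linarith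
    rw [sum_add_distrib, sum_const, card_univ, nsmul_eq_mul] at this
    linarith
  have up : ∑ i, sgb (s i) * (∑ k, a k * h k (y i)) ≤ 220 * Real.sqrt (Fintype.card ι * d) := by
    have e1 : ∑ i, sgb (s i) * (∑ k, a k * h k (y i)) = ∑ k, a k * ∑ i, sgb (s i) * h k (y i) := by
      simp_rw [mul_sum]
      rw [sum_comm]
      apply sum_congr rfl; intro k _; apply sum_congr rfl; intro i _; ring
    rw [e1]
    have e2 : ∀ k, ∑ i, sgb (s i) * h k (y i) ≤ 220 * Real.sqrt (Fintype.card ι * d) := by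
      intro k
      have hB : univ.filter (fun i => h k (y i) = 1) ∈ trF H y := by
        rw [mem_trF]; exact ⟨h k, hhH k, fun i => by simp⟩
      have := (le_abs_self _).trans (hs1 _ hB)
      refine le_trans (le_of_eq ?_) this
      apply sum_congr rfl
      intro i _
      congr 1
      rcases hH (h k) (hhH k) (y i) with h1 | h1
      · simp [chi, h1]
      · simp [chi, h1]; try norm_num
    calc _ ≤ ∑ k, a k * (220 * Real.sqrt (Fintype.card ι * d)) :=
          sum_le_sum (fun k _ => mul_le_mul_of_nonneg_left (e2 k) (ha k).le)
      _ = _ := by rw [← sum_mul, hasum, one_mul]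
  have h1 := low.trans up
  have h2 : (Fintype.card ι * β) ^ 2 ≤ (220 * Real.sqrt (Fintype.card ι * d)) ^ 2 := by
    gcongr
  rw [mul_pow, mul_pow, Real.sq_sqrt (by positivity)] at h2
  rw [le_div_iff₀ (by positivity)]
  have h3 : (Fintype.card ι : ℝ) * (Fintype.card ι * β ^ 2) ≤ Fintype.card ι * (48400 * d) := by
    nlinarith
  exact le_of_mul_le_mul_left h3 hn0

end Helpers3

section Helpers4
open Finset

/-- no balanced split -/
def NoSplit {β : Type*} (A : Finset β) (g : β → ℤ) : Prop :=
  ∀ c : ℤ, 0 < (A.filter (fun a => g a ≤ c)).card → 0 < (A.filter (fun a => c + 2 ≤ g a)).card →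
    Real.sqrt ((A.filter (fun a => g a ≤ c)).card) +
      Real.sqrt ((A.filter (fun a => c + 2 ≤ g a)).card) < Real.sqrt A.card

lemma nosplit_neg {β : Type*} (A : Finset β) (g : β → ℤ) (h : NoSplit A g) :
    NoSplit A (fun a => - g a) := by
  intro c h1 h2
  have e1 : A.filter (fun a => - g a ≤ c) = A.filter (fun a => (-c-2) + 2 ≤ g a) := by
    apply filter_congr; intro a _; constructor <;> intro h <;> linarith
  have e2 : A.filter (fun a => c + 2 ≤ - g a) = A.filter (fun a => g a ≤ -c-2) := by
    apply filter_congr; intro a _; constructor <;> intro h <;> linarith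
  rw [e1] at h1 ⊢
  rw [e2] at h2 ⊢
  have := h (-c-2) h2 h1
  linarith

lemma sqrt_step (N U V : ℝ) (hN : 0 < N) (hU : U ≤ N) (hV : 0 ≤ V)
    (h : Real.sqrt (N - U) + Real.sqrt V < Real.sqrt N) : V * N ≤ U ^ 2 := by
  set a := Real.sqrt N with ha
  set b := Real.sqrt (N - U) with hb
  set v := Real.sqrt V with hv
  have a2 : a ^ 2 = N := Real.sq_sqrt hN.le
  have b2 : b ^ 2 = N - U := Real.sq_sqrt (by linarith)
  have v2 : v ^ 2 = V := Real.sq_sqrt hV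
  have a0 : 0 ≤ a := Real.sqrt_nonneg _
  have b0 : 0 ≤ b := Real.sqrt_nonneg _
  have v0 : 0 ≤ v := Real.sqrt_nonneg _
  have hva : v * a ≤ U := by
    have : U = (a - b) * (a + b) := by nlinarith
    rw [this]
    have h1 : v ≤ a - b := by linarith
    calc v * a ≤ (a - b) * a := by gcongr
      _ ≤ (a - b) * (a + b) := by
        apply mul_le_mul_of_nonneg_left <;> linarith
  rw [← a2, ← v2, ← mul_pow]
  exact pow_le_pow_left₀ (by positivity) hva 2

lemma tail_one {β : Type*} (A : Finset β) (hA : 0 < A.card) (g : β → ℤ) (h : NoSplit A g) (μ : ℤ)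
    (hμ : 2 * (A.filter (fun a => μ + 1 ≤ g a)).card ≤ A.card) (j : ℕ) :
    ((A.filter (fun a => μ + 1 + j ≤ g a)).card : ℝ) ≤ A.card * (1 / 2) ^ (2 ^ j) := by
  have hN : (0:ℝ) < A.card := by exact_mod_cast hA
  induction j with
  | zero =>
    have : (2:ℝ) * (A.filter (fun a => μ + 1 ≤ g a)).card ≤ A.card := by exact_mod_cast hμ
    simp only [Nat.cast_zero, add_zero, pow_zero, pow_one]
    linarith
  | succ j ih =>
    set U := A.filter (fun a => μ + 1 + j ≤ g a) with hU
    set V := A.filter (fun a => μ + 1 + ((j + 1 : ℕ) : ℤ) ≤ g a) with hV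
    rcases Nat.eq_zero_or_pos V.card with h0 | h0
    · rw [h0, Nat.cast_zero]; positivity
    have eV : V = A.filter (fun a => (μ + j) + 2 ≤ g a) := by
      apply filter_congr; intro a _; push_cast; constructor <;> intro h <;> linarith
    have eU : (A.filter (fun a => g a ≤ μ + j)).card + U.card = A.card := by
      rw [add_comm, hU, ← card_filter_add_card_filter_not (s := A) (fun a => μ + 1 + j ≤ g a)]
      congr 2
      apply filter_congr; intro a _; constructor <;> intro h <;> omega
    have hUs : U.card ≤ (A.filter (fun a => μ + 1 ≤ g a)).card := by
      apply card_le_card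
      intro a ha
      simp only [hU, mem_filter] at ha ⊢
      exact ⟨ha.1, by have := ha.2; omega⟩
    have hp : 0 < (A.filter (fun a => g a ≤ μ + j)).card := by omega
    have hs := h (μ + j) hp (by rw [← eV]; exact h0)
    rw [← eV] at hs
    have eU' : (((A.filter (fun a => g a ≤ μ + j)).card : ℕ) : ℝ) = A.card - U.card := by
      rw [← eU]; push_cast; ring
    rw [eU'] at hs
    have hUN : (U.card : ℝ) ≤ A.card := by exact_mod_cast card_filter_le _ _
    have := sqrt_step A.card U.card V.card hN hUN (by positivity) hs
    have h3 : (U.card : ℝ) ^ 2 ≤ (A.card * (1 / 2) ^ (2 ^ j)) ^ 2 := by gcongr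
    rw [mul_pow, ← pow_mul, ← pow_succ] at h3
    have h4 : (A.card : ℝ) * V.card ≤ A.card * (A.card * (1 / 2) ^ (2 ^ (j+1))) := by nlinarith
    exact le_of_mul_le_mul_left h4 hN

lemma exists_median {β : Type*} (A : Finset β) (hA : 0 < A.card) (g : β → ℤ) :
    ∃ μ : ℤ, 2 * (A.filter (fun a => μ + 1 ≤ g a)).card ≤ A.card ∧
      2 * (A.filter (fun a => g a ≤ μ - 1)).card ≤ A.card := by
  classical
  have hne : A.Nonempty := card_pos.1 hA
  obtain ⟨lo, hlo, hlo'⟩ := exists_min_image A g hne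
  obtain ⟨hi, hhi, hhi'⟩ := exists_max_image A g hne
  have := Int.exists_least_of_bdd (P := fun z => A.card ≤ 2 * (A.filter (fun a => g a ≤ z)).card)
    ⟨g lo, by
      intro z hz
      by_contra hlt
      have : A.filter (fun a => g a ≤ z) = ∅ := by
        apply filter_eq_empty_iff.2
        intro a ha; have := hlo' a ha; omega
      simp only [this, card_empty] at hz; omega⟩
    ⟨g hi, by
      have : A.filter (fun a => g a ≤ g hi) = A := filter_true_of_mem (fun a ha => hhi' a ha)
      simp only [this]; omega⟩
  obtain ⟨μ, h1, h2⟩ := this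
  refine ⟨μ, ?_, ?_⟩
  · have e := card_filter_add_card_filter_not (s := A) (fun a => g a ≤ μ)
    have : A.filter (fun a => μ + 1 ≤ g a) = A.filter (fun a => ¬ g a ≤ μ) := by
      apply filter_congr; intro a _; constructor <;> intro h <;> omega
    rw [this]; omega
  · by_contra hcon
    have := h2 (μ - 1) (by omega)
    omega

lemma tail_two {β : Type*} (A : Finset β) (hA : 0 < A.card) (g : β → ℤ) (h : NoSplit A g) :
    ∃ μ : ℤ, ∀ j : ℕ, ((A.filter (fun a => (j:ℤ) + 1 ≤ |g a - μ|)).card : ℝ) ≤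
      2 * A.card * (1 / 2) ^ (2 ^ j) := by
  classical
  obtain ⟨μ, h1, h2⟩ := exists_median A hA g
  refine ⟨μ, fun j => ?_⟩
  have a1 := tail_one A hA g h μ h1 j
  have a2 := tail_one A hA (fun a => - g a) (nosplit_neg A g h) (-μ) (by
    have : A.filter (fun a => -μ + 1 ≤ - g a) = A.filter (fun a => g a ≤ μ - 1) := by
      apply filter_congr; intro a _; constructor <;> intro h <;> omega
    rw [this]; exact h2) j
  have hsub : A.filter (fun a => (j:ℤ) + 1 ≤ |g a - μ|) ⊆
      A.filter (fun a => μ + 1 + j ≤ g a) ∪ A.filter (fun a => -μ + 1 + j ≤ - g a) := by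
    intro a ha
    simp only [mem_filter, mem_union] at ha ⊢
    rcases le_abs.1 ha.2 with h | h
    · left; exact ⟨ha.1, by omega⟩
    · right; exact ⟨ha.1, by omega⟩
  have h3 := (card_le_card hsub).trans (card_union_le _ _)
  have h3' : ((A.filter (fun a => (j:ℤ) + 1 ≤ |g a - μ|)).card : ℝ) ≤
    (A.filter (fun a => μ + 1 + j ≤ g a)).card + (A.filter (fun a => -μ + 1 + j ≤ - g a)).card := by
    exact_mod_cast h3
  linarith

lemma exists_split {ι : Type*} [Fintype ι] [DecidableEq ι] (A : Finset (ι → ℤ)) (hA : 2 ≤ A.card)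
    (j k : ℕ) (hjk : (8 * Fintype.card ι : ℝ) ≤ k * 2 ^ (2 ^ j))
    (hsep : ∀ a ∈ A, ∀ a' ∈ A, a ≠ a' →
      k < ((univ : Finset ι).filter (fun i => (2 * j + 1 : ℤ) ≤ |a i - a' i|)).card) :
    ∃ i, ¬ NoSplit A (fun a => a i) := by
  classical
  by_contra hcon
  push Not at hcon
  have hN : (0:ℝ) < A.card := by
    have : 0 < A.card := by omega
    exact_mod_cast this
  have := fun i => tail_two A (by omega) (fun a => a i) (hcon i)
  choose μ hμ using this
  set bad : (ι → ℤ) → Finset ι := fun a => univ.filter (fun i => (j:ℤ) + 1 ≤ |a i - μ i|) with hbad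
  have hsum : ∑ a ∈ A, (bad a).card = ∑ i, (A.filter (fun a => (j:ℤ) + 1 ≤ |a i - μ i|)).card := by
    simp only [hbad, card_filter]
    exact sum_comm
  have hsum2 : (∑ a ∈ A, ((bad a).card : ℝ)) ≤ A.card * k / 4 := by
    rw [← Nat.cast_sum, hsum, Nat.cast_sum]
    calc _ ≤ ∑ i : ι, 2 * (A.card:ℝ) * (1 / 2) ^ (2 ^ j) := sum_le_sum (fun i _ => hμ i j)
      _ = (8 * Fintype.card ι) * (A.card * (1/2) ^ (2^j)) / 4 := by
          rw [sum_const, card_univ, nsmul_eq_mul]; ring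
      _ ≤ (k * 2 ^ (2 ^ j)) * (A.card * (1/2) ^ (2^j)) / 4 := by gcongr
      _ = A.card * k / 4 * (2 ^ (2 ^ j) * (1/2) ^ (2^j)) := by ring
      _ = _ := by rw [← mul_pow]; norm_num
  set G := A.filter (fun a => 2 * (bad a).card ≤ k) with hG
  set G' := A.filter (fun a => ¬ 2 * (bad a).card ≤ k) with hG'
  have hGG : G.card + G'.card = A.card := card_filter_add_card_filter_not _
  have h1 : (G'.card : ℝ) * ((k + 1) / 2) ≤ A.card * k / 4 := by
    refine le_trans ?_ hsum2
    rw [← nsmul_eq_mul, ← sum_const]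
    calc _ ≤ ∑ a ∈ G', ((bad a).card : ℝ) := by
          apply sum_le_sum
          intro a ha
          have : k + 1 ≤ 2 * (bad a).card := by
            have := (mem_filter.1 ha).2; omega
          have : (k + 1 : ℝ) ≤ 2 * (bad a).card := by exact_mod_cast this
          linarith
      _ ≤ _ := sum_le_sum_of_subset_of_nonneg (filter_subset _ _) (fun _ _ _ => by positivity)
  have h2 : (2:ℝ) * G'.card < A.card := by
    have hk0 : (0:ℝ) ≤ k := by positivity
    by_contra hc
    push Not at hc
    nlinarith
  have h2' : 2 * G'.card < A.card := by exact_mod_cast h2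
  have h3 : 1 < G.card := by omega
  obtain ⟨a, ha, a', ha', hne⟩ := one_lt_card.1 h3
  have ha := mem_filter.1 ha
  have ha' := mem_filter.1 ha'
  have hs := hsep a ha.1 a' ha'.1 hne
  have hsub : (univ : Finset ι).filter (fun i => (2 * j + 1 : ℤ) ≤ |a i - a' i|) ⊆ bad a ∪ bad a' := by
    intro i hi
    simp only [hbad, mem_filter, mem_univ, true_and, mem_union] at hi ⊢
    by_contra hc
    push Not at hc
    have e1 := abs_lt.1 hc.1
    have e2 := abs_lt.1 hc.2
    rcases le_abs.1 hi with h | h <;> omega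
  have := (card_le_card hsub).trans (card_union_le _ _)
  omega

/-- shattered cell -/
def ShC {ι : Type*} (A : Finset (ι → ℤ)) (p : Finset ι × (ι → ℤ)) : Prop :=
  (∀ i, i ∉ p.1 → p.2 i = 0) ∧
  ∀ T : Finset ι, ∃ a ∈ A, ∀ i ∈ p.1, (i ∈ T → p.2 i + 2 ≤ a i) ∧ (i ∉ T → a i ≤ p.2 i)

/-- universe of cells -/
noncomputable def cellU {ι : Type*} [Fintype ι] [DecidableEq ι] (Q : ℤ) : Finset (Finset ι × (ι → ℤ)) :=
  univ ×ˢ Fintype.piFinset (fun _ => Icc (-Q) Q)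

/-- shattered cells -/
noncomputable def cells {ι : Type*} [Fintype ι] [DecidableEq ι] (Q : ℤ) (A : Finset (ι → ℤ)) :
    Finset (Finset ι × (ι → ℤ)) := by
  classical exact (cellU Q).filter (ShC A)

lemma mem_cells {ι : Type*} [Fintype ι] [DecidableEq ι] (Q : ℤ) (A : Finset (ι → ℤ))
    (p : Finset ι × (ι → ℤ)) :
    p ∈ cells Q A ↔ (∀ i, p.2 i ∈ Icc (-Q) Q) ∧ ShC A p := by
  classical
  simp [cells, cellU]

lemma ShC_mono {ι : Type*} {A B : Finset (ι → ℤ)} (h : A ⊆ B) {p : Finset ι × (ι → ℤ)}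
    (hp : ShC A p) : ShC B p :=
  ⟨hp.1, fun T => by obtain ⟨a, ha, h2⟩ := hp.2 T; exact ⟨a, h ha, h2⟩⟩

lemma cells_split {ι : Type*} [Fintype ι] [DecidableEq ι] (Q : ℤ) (A : Finset (ι → ℤ))
    (hQ : ∀ a ∈ A, ∀ i, a i ∈ Icc (-Q) Q) (i : ι) (c : ℤ)
    (h1 : 0 < (A.filter (fun a => a i ≤ c)).card) (h2 : 0 < (A.filter (fun a => c + 2 ≤ a i)).card) :
    (cells Q (A.filter (fun a => a i ≤ c))).card + (cells Q (A.filter (fun a => c + 2 ≤ a i))).card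
      ≤ (cells Q A).card := by
  classical
  set L := A.filter (fun a => a i ≤ c) with hL
  set U := A.filter (fun a => c + 2 ≤ a i) with hU
  have hLA : L ⊆ A := filter_subset _ _
  have hUA : U ⊆ A := filter_subset _ _
  obtain ⟨al, hal⟩ := card_pos.1 h1
  obtain ⟨au, hau⟩ := card_pos.1 h2
  have hcQ : c ∈ Icc (-Q) Q := by
    have e1 := mem_Icc.1 (hQ al (hLA hal) i)
    have e2 := mem_Icc.1 (hQ au (hUA hau) i)
    have e3 := (mem_filter.1 hal).2
    have e4 := (mem_filter.1 hau).2
    rw [mem_Icc]; omega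
  have hboth : ∀ p, ShC L p → ShC U p → i ∉ p.1 := by
    intro p hp hp' hi
    obtain ⟨a, ha, ha2⟩ := hp.2 univ
    obtain ⟨b, hb, hb2⟩ := hp'.2 ∅
    have e1 := (ha2 i hi).1 (mem_univ _)
    have e2 := (hb2 i hi).2 (notMem_empty _)
    have e3 := (mem_filter.1 ha).2
    have e4 := (mem_filter.1 hb).2
    omega
  set φ : Finset ι × (ι → ℤ) → Finset ι × (ι → ℤ) := fun p => (insert i p.1, Function.update p.2 i c) with hφ
  have hsub : (cells Q L ∪ cells Q U) ∪ (cells Q L ∩ cells Q U).image φ ⊆ cells Q A := by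
    intro p hp
    rcases mem_union.1 hp with hp | hp
    · rcases mem_union.1 hp with hp | hp <;> rw [mem_cells] at hp ⊢
      · exact ⟨hp.1, ShC_mono hLA hp.2⟩
      · exact ⟨hp.1, ShC_mono hUA hp.2⟩
    · obtain ⟨p', hp', rfl⟩ := mem_image.1 hp
      rw [mem_inter, mem_cells, mem_cells] at hp'
      obtain ⟨⟨hr, hl⟩, ⟨-, hu⟩⟩ := hp'
      have hi := hboth p' hl hu
      rw [mem_cells]
      refine ⟨?_, ?_, ?_⟩
      · intro x
        by_cases hx : x = i
        · subst hx; simpa [hφ] using hcQ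
        · simpa [hφ, Function.update_of_ne hx] using hr x
      · intro x hx
        simp only [hφ, mem_insert, not_or] at hx
        simp only [hφ, Function.update_of_ne hx.1]
        exact hl.1 x hx.2
      · intro T
        by_cases hT : i ∈ T
        · obtain ⟨a, ha, ha2⟩ := hu.2 T
          refine ⟨a, hUA ha, ?_⟩
          intro x hx
          simp only [hφ, mem_insert] at hx
          by_cases hxi : x = i
          · subst hxi
            simp only [hφ, Function.update_self]
            exact ⟨fun _ => (mem_filter.1 ha).2, fun h => absurd hT h⟩
          · simp only [hφ, Function.update_of_ne hxi]
            exact ha2 x (hx.resolve_left hxi)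
        · obtain ⟨a, ha, ha2⟩ := hl.2 T
          refine ⟨a, hLA ha, ?_⟩
          intro x hx
          simp only [hφ, mem_insert] at hx
          by_cases hxi : x = i
          · subst hxi
            simp only [hφ, Function.update_self]
            exact ⟨fun h => absurd h hT, fun _ => (mem_filter.1 ha).2⟩
          · simp only [hφ, Function.update_of_ne hxi]
            exact ha2 x (hx.resolve_left hxi)
  have hdisj : Disjoint (cells Q L ∪ cells Q U) ((cells Q L ∩ cells Q U).image φ) := by
    rw [disjoint_left]
    intro p hp hp'
    obtain ⟨p', hp', rfl⟩ := mem_image.1 hp'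
    rcases mem_union.1 hp with hp | hp <;> rw [mem_cells] at hp
    · obtain ⟨a, ha, ha2⟩ := hp.2.2 univ
      have e1 := (ha2 i (by simp [hφ])).1 (mem_univ _)
      simp only [hφ, Function.update_self] at e1
      have e3 := (mem_filter.1 ha).2
      omega
    · obtain ⟨a, ha, ha2⟩ := hp.2.2 ∅
      have e1 := (ha2 i (by simp [hφ])).2 (notMem_empty _)
      simp only [hφ, Function.update_self] at e1
      have e3 := (mem_filter.1 ha).2
      omega
  have hinj : Set.InjOn φ (cells Q L ∩ cells Q U : Finset _) := by
    intro p hp p' hp' he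
    rw [mem_coe, mem_inter, mem_cells, mem_cells] at hp hp'
    have i1 := hboth p hp.1.2 hp.2.2
    have i2 := hboth p' hp'.1.2 hp'.2.2
    have he1 : insert i p.1 = insert i p'.1 := congrArg Prod.fst he
    have he2 : Function.update p.2 i c = Function.update p'.2 i c := congrArg Prod.snd he
    apply Prod.ext
    · rw [← erase_insert i1, he1, erase_insert i2]
    · funext x
      by_cases hx : x = i
      · subst hx; rw [hp.1.2.1 x i1, hp'.1.2.1 x i2]
      · have := congrFun he2 x
        simpa [Function.update_of_ne hx] using this
  have hc := card_le_card hsub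
  rw [card_union_of_disjoint hdisj, card_image_of_injOn hinj, card_union_add_card_inter] at hc
  exact hc

lemma card_le_cells_sq {ι : Type*} [Fintype ι] [DecidableEq ι] (Q : ℤ) (hQ0 : 0 ≤ Q) (j k : ℕ)
    (hjk : (8 * Fintype.card ι : ℝ) ≤ k * 2 ^ (2 ^ j)) (n : ℕ) :
    ∀ A : Finset (ι → ℤ), A.card = n → (∀ a ∈ A, ∀ i, a i ∈ Icc (-Q) Q) →
    (∀ a ∈ A, ∀ a' ∈ A, a ≠ a' →
      k < ((univ : Finset ι).filter (fun i => (2 * j + 1 : ℤ) ≤ |a i - a' i|)).card) →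
    Real.sqrt A.card ≤ (cells Q A).card := by
  induction n using Nat.strong_induction_on with
  | _ n ih =>
  intro A hAn hQ hsep
  classical
  rcases Nat.lt_or_ge A.card 2 with hA | hA
  · rcases Nat.eq_zero_or_pos A.card with h0 | h0
    · rw [h0]; simp
    · have h1 : A.card = 1 := by omega
      rw [h1]
      obtain ⟨a, ha⟩ := card_pos.1 h0
      have : ((∅ : Finset ι), (0 : ι → ℤ)) ∈ cells Q A := by
        rw [mem_cells]
        refine ⟨fun i => by simp [hQ0], fun i _ => rfl, fun T => ⟨a, ha, by simp⟩⟩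
      have : 0 < (cells Q A).card := card_pos.2 ⟨_, this⟩
      have : (1:ℝ) ≤ (cells Q A).card := by exact_mod_cast this
      simpa using this
  · obtain ⟨i, hi⟩ := exists_split A hA j k hjk hsep
    simp only [NoSplit] at hi
    push Not at hi
    obtain ⟨c, h1, h2, h3⟩ := hi
    have hs := cells_split Q A hQ i c h1 h2
    set L := A.filter (fun a => a i ≤ c) with hL
    set U := A.filter (fun a => c + 2 ≤ a i) with hU
    have hLA : L ⊆ A := filter_subset _ _
    have hUA : U ⊆ A := filter_subset _ _
    have hd : Disjoint L U := by
      rw [disjoint_left]; intro a ha hb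
      have e3 := (mem_filter.1 ha).2
      have e4 := (mem_filter.1 hb).2
      omega
    have hLU : L.card + U.card ≤ A.card := by
      rw [← card_union_of_disjoint hd]; exact card_le_card (union_subset hLA hUA)
    have iL := ih L.card (by omega) L rfl (fun a ha => hQ a (hLA ha))
      (fun a ha a' ha' => hsep a (hLA ha) a' (hLA ha'))
    have iU := ih U.card (by omega) U rfl (fun a ha => hQ a (hUA ha))
      (fun a ha a' ha' => hsep a (hUA ha) a' (hUA ha'))
    have hs' : ((cells Q L).card : ℝ) + (cells Q U).card ≤ (cells Q A).card := by exact_mod_cast hs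
    linarith

/-- small-support cells -/
noncomputable def smallU {ι : Type*} [Fintype ι] [DecidableEq ι] (Q : ℤ) (k : ℕ) :
    Finset (Σ _ : Finset ι, (ι → ℤ)) :=
  ((univ : Finset (Finset ι)).filter (fun S => S.card ≤ k)).sigma
    (fun S => Fintype.piFinset (fun i => if i ∈ S then Icc (-Q) Q else {0}))

lemma smallU_card {ι : Type*} [Fintype ι] [DecidableEq ι] (Q : ℕ) (k : ℕ) :
    ((smallU (ι := ι) Q k).card : ℝ) =
      ∑ S ∈ (univ : Finset (Finset ι)).filter (fun S => S.card ≤ k), (2 * Q + 1 : ℝ) ^ S.card := by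
  rw [smallU, card_sigma, Nat.cast_sum]
  apply sum_congr rfl
  intro S _
  rw [Fintype.card_piFinset]
  have : ∀ i, (if i ∈ S then Icc (-(Q:ℤ)) Q else {0}).card = if i ∈ S then 2 * Q + 1 else 1 := by
    intro i
    split_ifs
    · rw [Int.card_Icc]; omega
    · simp
  simp_rw [this]
  rw [Fintype.prod_ite_mem, prod_const]
  push_cast; rfl

lemma cells_card_le {ι : Type*} [Fintype ι] [DecidableEq ι] (Q : ℤ) (k : ℕ) (A : Finset (ι → ℤ))
    (hk : ∀ p, ShC A p → p.1.card ≤ k) :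
    (cells Q A).card ≤ (smallU (ι := ι) Q k).card := by
  apply card_le_card_of_injOn (fun p => ⟨p.1, p.2⟩)
  · intro p hp
    rw [mem_coe, mem_cells] at hp
    simp only [smallU, coe_sigma, Set.mem_sigma_iff, mem_coe, mem_filter, mem_univ, true_and,
      Fintype.mem_piFinset]
    refine ⟨hk p hp.2, fun i => ?_⟩
    split_ifs with h
    · exact hp.1 i
    · simp [hp.2.1 i h]
  · intro p _ p' _ h
    simp only [Sigma.mk.injEq, heq_eq_eq] at h
    exact Prod.ext h.1 h.2

end Helpers4

section Helpers5
open Finset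

lemma clip_le {X : Type*} (γ : ℝ) (hγ : 0 < γ) (f : X → ℝ) (x : X) :
    -γ ≤ clip γ f x ∧ clip γ f x ≤ γ := by
  unfold clip
  split_ifs <;> constructor <;> linarith

lemma clip_up {X : Type*} (γ : ℝ) (f : X → ℝ) (x : X) (w : ℝ) (hw : -γ < w)
    (h : w ≤ clip γ f x) : w ≤ f x := by
  unfold clip at h
  split_ifs at h <;> linarith

lemma clip_dn {X : Type*} (γ : ℝ) (f : X → ℝ) (x : X) (w : ℝ) (hw : w < γ)
    (h : clip γ f x ≤ w) : f x ≤ w := by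
  unfold clip at h
  split_ifs at h <;> linarith

/-- quantization -/
noncomputable def qz {X : Type*} {m : ℕ} (xs : Fin m → X) (γ s : ℝ) (f : X → ℝ) (i : Fin m) : ℤ :=
  ⌊clip γ f (xs i) / s⌋

lemma qz_lo {X : Type*} {m : ℕ} (xs : Fin m → X) (γ s : ℝ) (hs : 0 < s) (f : X → ℝ) (i : Fin m) :
    s * qz xs γ s f i ≤ clip γ f (xs i) := by
  have := Int.floor_le (clip γ f (xs i) / s)
  rw [le_div_iff₀ hs] at this
  rw [mul_comm]; exact this

lemma qz_hi {X : Type*} {m : ℕ} (xs : Fin m → X) (γ s : ℝ) (hs : 0 < s) (f : X → ℝ) (i : Fin m) :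
    clip γ f (xs i) < s * (qz xs γ s f i + 1) := by
  have := Int.lt_floor_add_one (clip γ f (xs i) / s)
  rw [div_lt_iff₀ hs] at this
  rw [mul_comm]; exact this

lemma cover_main (X : Type) (m : ℕ) (xs : Fin m → X) (H : Set (X → ℝ))
    (hH : ∀ h ∈ H, ∀ x, h x = 1 ∨ h x = -1) (d : ℕ) (hd0 : 0 < d)
    (hd : ∀ s : Finset X, ShattersPM H s → s.card ≤ d) (γ s ε : ℝ) (hγ : 0 < γ) (hs : 0 < s)
    (j k Q : ℕ) (hk : 48400 * d / (s / 2) ^ 2 ≤ (k : ℝ)) (hjk : (8 * m : ℝ) ≤ k * 2 ^ (2 ^ j))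
    (hε : (2 * j + 1) * s ≤ ε) (hQ : γ / s ≤ Q) :
    coveringNumber xs (clipClass (votingClassifiers H) γ) ε ≤
      ENNReal.ofReal ((∑ S ∈ (univ : Finset (Finset (Fin m))).filter (fun S => S.card ≤ k),
        (2 * Q + 1 : ℝ) ^ S.card) ^ 3) := by
  classical
  rw [← smallU_card]
  set M := (smallU (ι := Fin m) (Q : ℤ) k).card with hM
  have hqQ : ∀ f i, qz xs γ s f i ∈ Icc (-(Q:ℤ)) Q := by
    intro f i
    have h1 := qz_lo xs γ s hs f i
    have h2 := qz_hi xs γ s hs f i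
    have h3 := clip_le γ hγ f (xs i)
    rw [div_le_iff₀ hs] at hQ
    rw [mem_Icc]
    constructor
    · have : s * (-(Q:ℝ)) < s * ((qz xs γ s f i : ℝ) + 1) := by nlinarith
      have := lt_of_mul_lt_mul_left this hs.le
      have : (-(Q:ℤ)) < qz xs γ s f i + 1 := by exact_mod_cast this
      omega
    · have : s * (qz xs γ s f i : ℝ) ≤ s * Q := by nlinarith
      have := le_of_mul_le_mul_left this hs
      exact_mod_cast this
  set F : Finset (Fin m → ℤ) := (Fintype.piFinset (fun _ => Icc (-(Q:ℤ)) Q)).filter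
    (fun a => ∃ f ∈ votingClassifiers H, a = qz xs γ s f) with hF
  obtain ⟨A, hAF, hsep, hcov⟩ := exists_net F (fun a a' =>
    k < ((univ : Finset (Fin m)).filter (fun i => (2 * j + 1 : ℤ) ≤ |a i - a' i|)).card)
    (fun a b h => by
      have : ∀ i, |b i - a i| = |a i - b i| := fun i => abs_sub_comm _ _
      simp_rw [this]; exact h)
  have hAQ : ∀ a ∈ A, ∀ i, a i ∈ Icc (-(Q:ℤ)) Q := by
    intro a ha i
    exact Fintype.mem_piFinset.1 (mem_filter.1 (hAF ha)).1 i
  have hcell := card_le_cells_sq (ι := Fin m) (Q:ℤ) (by positivity) j k (by simpa using hjk) A.card A rfl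
    hAQ hsep
  have hfat : ∀ p, ShC A p → p.1.card ≤ k := by
    intro p hp
    have hb := fat_bound H (fun i : p.1 => xs i) hH d hd0 hd (fun i => s * (p.2 i + 3 / 2)) (s / 2)
      (by positivity) (by
        intro b
        have hlow : ∀ i ∈ p.1, -γ < s * ((p.2 i : ℝ) + 1) := by
          intro i hi
          obtain ⟨a, ha, ha2⟩ := hp.2 ∅
          obtain ⟨f, -, rfl⟩ := (mem_filter.1 (hAF ha)).2
          have e1 := (ha2 i hi).2 (notMem_empty _)
          have e2 := qz_hi xs γ s hs f i
          have e3 := clip_le γ hγ f (xs i)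
          have e1' : (qz xs γ s f i : ℝ) ≤ p.2 i := by exact_mod_cast e1
          nlinarith
        have hupp : ∀ i ∈ p.1, s * ((p.2 i : ℝ) + 2) ≤ γ := by
          intro i hi
          obtain ⟨a, ha, ha2⟩ := hp.2 univ
          obtain ⟨f, -, rfl⟩ := (mem_filter.1 (hAF ha)).2
          have e1 := (ha2 i hi).1 (mem_univ _)
          have e2 := qz_lo xs γ s hs f i
          have e3 := clip_le γ hγ f (xs i)
          have e1' : (p.2 i : ℝ) + 2 ≤ (qz xs γ s f i : ℝ) := by exact_mod_cast e1
          nlinarith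
        obtain ⟨a, ha, ha2⟩ := hp.2 (univ.filter (fun i => ∃ h : i ∈ p.1, b ⟨i, h⟩ = true))
        obtain ⟨f, hf, rfl⟩ := (mem_filter.1 (hAF ha)).2
        refine ⟨f, hf, ?_⟩
        rintro ⟨i, hi⟩
        have h1 := hlow i hi
        have h2 := hupp i hi
        constructor
        · intro hb
          have e1 := (ha2 i hi).1 (by simp [hi, hb])
          have e1' : (p.2 i : ℝ) + 2 ≤ (qz xs γ s f i : ℝ) := by exact_mod_cast e1
          have e2 := qz_lo xs γ s hs f i
          apply clip_up γ f (xs i) _ (by simp only; nlinarith)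
          simp only
          nlinarith
        · intro hb
          have e1 := (ha2 i hi).2 (by simp [hi, hb])
          have e1' : (qz xs γ s f i : ℝ) ≤ p.2 i := by exact_mod_cast e1
          have e2 := qz_hi xs γ s hs f i
          apply clip_dn γ f (xs i) _ (by simp only; nlinarith)
          simp only
          nlinarith)
    rw [Fintype.card_coe] at hb
    exact_mod_cast hb.trans hk
  have hAM : (A.card : ℝ) ≤ (M:ℝ) ^ 2 := by
    have h1 : ((cells (Q:ℤ) A).card : ℝ) ≤ M := by
      exact_mod_cast cells_card_le (Q:ℤ) k A hfat
    have h2 := hcell.trans h1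
    exact (Real.sqrt_le_left (by positivity)).1 h2
  set mk : (Fin m → ℤ) × (Σ _ : Finset (Fin m), (Fin m → ℤ)) → X → ℝ := fun p x =>
    if h : ∃ i, xs i = x then
      s * ((if h.choose ∈ p.2.1 then p.2.2 h.choose else p.1 h.choose : ℤ) : ℝ) else 0 with hmk
  set N : Finset (X → ℝ) := (A ×ˢ smallU (ι := Fin m) (Q:ℤ) k).image mk with hN
  have hNc : N.card ≤ A.card * M := by
    rw [hM, ← card_product]; exact card_image_le
  have hNcov : IsCoverOn xs (clipClass (votingClassifiers H) γ) ε N := by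
    rintro _ ⟨f, hf, rfl⟩
    have hqF : qz xs γ s f ∈ F := by
      rw [hF, mem_filter, Fintype.mem_piFinset]
      exact ⟨hqQ f, f, hf, rfl⟩
    obtain ⟨a, ha, hnear⟩ := hcov _ hqF
    set B := (univ : Finset (Fin m)).filter (fun i => (2 * j + 1 : ℤ) ≤ |qz xs γ s f i - a i|) with hB
    have hBk : B.card ≤ k := by
      rcases hnear with h | h
      · have : B = ∅ := by
          rw [hB]; apply filter_eq_empty_iff.2
          intro i _
          rw [h]; simp <;> omega
        rw [this]; simp
      · exact not_lt.1 h
    set v : Fin m → ℤ := fun i => if i ∈ B then qz xs γ s f i else 0 with hv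
    refine ⟨mk (a, ⟨B, v⟩), ?_, ?_⟩
    · apply mem_image_of_mem
      rw [mem_product]
      refine ⟨ha, ?_⟩
      simp only [smallU, mem_sigma, mem_filter, mem_univ, true_and, Fintype.mem_piFinset]
      refine ⟨hBk, fun i => ?_⟩
      by_cases hi : i ∈ B
      · simp only [hv, hi, if_true]; exact hqQ f i
      · simp only [hv, hi, if_false]; simp
    · intro i0
      have hex : ∃ i, xs i = xs i0 := ⟨i0, rfl⟩
      have hval : mk (a, ⟨B, v⟩) (xs i0) =
          s * ((if hex.choose ∈ B then v hex.choose else a hex.choose : ℤ) : ℝ) := by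
        simp only [hmk]
        rw [dif_pos hex]
      rw [hval]
      have hspec := hex.choose_spec
      generalize hex.choose = i at hspec ⊢
      rw [← hspec]
      have e1 := qz_lo xs γ s hs f i
      have e2 := qz_hi xs γ s hs f i
      have hj0 : (0:ℝ) ≤ j := by positivity
      by_cases hi : i ∈ B
      · simp only [hv, hi, if_true]
        rw [abs_le]
        constructor <;> nlinarith
      · simp only [hi, if_false]
        have hi' : |qz xs γ s f i - a i| ≤ 2 * j := by
          rw [hB, mem_filter] at hi
          simp only [mem_univ, true_and] at hi
          omega
        rw [abs_le] at hi'
        have e3 : (-(2 * j) : ℝ) ≤ qz xs γ s f i - a i := by exact_mod_cast hi'.1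
        have e4 : (qz xs γ s f i - a i : ℝ) ≤ 2 * j := by exact_mod_cast hi'.2
        rw [abs_le]
        constructor <;> nlinarith
  calc coveringNumber xs (clipClass (votingClassifiers H) γ) ε ≤ (N.card : ℝ≥0∞) :=
        iInf₂_le N hNcov
    _ = ENNReal.ofReal (N.card : ℝ) := by simp
    _ ≤ _ := by
        apply ENNReal.ofReal_le_ofReal
        have : (N.card : ℝ) ≤ A.card * M := by exact_mod_cast hNc
        have hM0 : (0:ℝ) ≤ M := by positivity
        nlinarith

end Helpers5

section Helpers6
open Finset

lemma one_le_Ln (x : ℝ) : 1 ≤ Ln x := by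
  unfold Ln
  rw [Real.le_log_iff_exp_le (lt_of_lt_of_le (Real.exp_pos 1) (le_max_right _ _))]
  exact le_max_right _ _

lemma le_exp_Ln (x : ℝ) : x ≤ Real.exp (Ln x) := by
  unfold Ln
  rw [Real.exp_log (lt_of_lt_of_le (Real.exp_pos 1) (le_max_right _ _))]
  exact le_max_left _ _

lemma cover_one {X : Type*} {m : ℕ} (xs : Fin m → X) (F : Set (X → ℝ)) (ε : ℝ) (g : X → ℝ)
    (h : ∀ f ∈ F, ∀ i, |f (xs i) - g (xs i)| ≤ ε) : coveringNumber xs F ε ≤ 1 := by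
  have h1 : IsCoverOn xs F ε {g} := fun f hf => ⟨g, by simp, h f hf⟩
  refine (iInf₂_le ({g} : Finset (X → ℝ)) h1).trans ?_
  simp

set_option maxHeartbeats 2000000 in
lemma cover_pos (X : Type) (m : ℕ) (xs : Fin m → X) (H : Set (X → ℝ))
    (hH : ∀ h ∈ H, ∀ x, h x = 1 ∨ h x = -1) (d : ℕ) (hd0 : 0 < d)
    (hd : ∀ s : Finset X, ShattersPM H s → s.card ≤ d) (α γ y : ℝ) (hα : 0 < α) (hα2 : α < 1 / 2)
    (hγ : 0 < γ) (hγ1 : γ ≤ 1) (hm : 0 < m) (hy : y = 8 * α * m * γ ^ 2 / (12390400 * d))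
    (hyp : γ ^ 2 ≥ 4 * 12390400 * d * (Ln (Ln y)) ^ 2 / (α ^ 2 * m)) :
    coveringNumber xs (clipClass (votingClassifiers H) γ) (α * γ) ≤
      ENNReal.ofReal (Real.exp ((24 * 12390400 * d / (α ^ 2 * γ ^ 2)) * func y)) := by
  have hmR : (0:ℝ) < m := by exact_mod_cast hm
  have hdR : (1:ℝ) ≤ d := by exact_mod_cast hd0
  set L := Ln y with hL
  set l := Ln L with hl
  have hL1 : 1 ≤ L := one_le_Ln y
  have hl1 : 1 ≤ l := one_le_Ln L
  have hy0 : 0 < y := by rw [hy]; positivity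
  have hyL : y ≤ Real.exp L := le_exp_Ln y
  have hLl : Real.log L ≤ l := by
    have := le_exp_Ln L
    rw [← hl] at this
    rwa [Real.log_le_iff_le_exp (by linarith)]
  clear_value l
  clear_value L
  have hlog2 : (2/3:ℝ) < Real.log 2 := by have := Real.log_two_gt_d9; linarith
  -- choice of j
  set j : ℕ := ⌈Real.log (2 * L) / Real.log 2⌉₊ with hj
  clear_value j
  have hj1 : 2 * L ≤ 2 ^ j := by
    have h1 := Nat.le_ceil (Real.log (2 * L) / Real.log 2)
    rw [← hj, div_le_iff₀ (by linarith)] at h1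
    have h2 : Real.log (2 * L) ≤ Real.log (2 ^ j) := by rw [Real.log_pow]; exact h1
    exact (Real.log_le_log_iff (by positivity) (by positivity)).1 h2
  have hj2 : (2 * j + 1 : ℝ) ≤ 8 * l := by
    have h1 := Nat.ceil_lt_add_one (a := Real.log (2 * L) / Real.log 2)
      (div_nonneg (Real.log_nonneg (by linarith)) (by linarith))
    rw [← hj] at h1
    have h2 : Real.log (2 * L) / Real.log 2 = 1 + Real.log L / Real.log 2 := by
      rw [Real.log_mul (by norm_num) (by linarith)]
      have : Real.log 2 ≠ 0 := by linarith
      field_simp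
    have h3 : Real.log L / Real.log 2 ≤ 3 / 2 * l := by
      rw [div_le_iff₀ (by linarith)]
      nlinarith
    linarith
  have hpow : y ≤ 2 ^ (2 ^ j) := by
    have e : (2:ℝ) ^ (2 ^ j) = Real.exp (2 ^ j * Real.log 2) := by
      have := Real.exp_nat_mul (Real.log 2) (2 ^ j)
      rw [Real.exp_log (by norm_num)] at this
      push_cast at this
      exact this.symm
    rw [e]
    refine hyL.trans ?_
    rw [Real.exp_le_exp]
    nlinarith
  set ε := α * γ with hε
  have hε0 : 0 < ε := by positivity
  have hε1 : ε ≤ 1 := by rw [hε]; nlinarith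
  set s := ε / (8 * l) with hs
  clear_value s
  have hs0 : 0 < s := by rw [hs]; positivity
  set v : ℝ := 12390400 * d * l ^ 2 / ε ^ 2 with hv
  clear_value v
  clear_value ε
  have hv1 : 1 ≤ v := by
    rw [hv, le_div_iff₀ (by positivity)]
    have h1 : ε ^ 2 ≤ 1 := by nlinarith
    have h2 : 1 ≤ l ^ 2 := by nlinarith
    nlinarith
  have hvs : 48400 * d / (s / 2) ^ 2 = v := by
    rw [hv, hs]; field_simp; norm_num
  set k : ℕ := ⌈v⌉₊ with hk
  have hkv : v ≤ k := Nat.le_ceil v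
  clear_value k
  have hkv2 : (k:ℝ) ≤ 2 * v := by
    have := Nat.ceil_lt_add_one (a := v) (by linarith)
    rw [← hk] at this
    linarith
  have hk0 : 0 < k := by
    have : (0:ℝ) < k := by linarith
    exact_mod_cast this
  have hmv : 4 * v ≤ m := by
    rw [ge_iff_le, div_le_iff₀ (by positivity)] at hyp
    have : 4 * v = (4 * 12390400 * d * l ^ 2) / ε ^ 2 := by rw [hv]; ring
    rw [this, div_le_iff₀ (by positivity), hε]
    nlinarith
  have hvy : v * y = 8 * m * l ^ 2 / α := by
    rw [hv, hy, hε]; field_simp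
  have hjk : (8 * m : ℝ) ≤ k * 2 ^ (2 ^ j) := by
    calc (8 * m : ℝ) ≤ 8 * m * l ^ 2 / α := by
          rw [le_div_iff₀ hα]
          have h2 : 1 ≤ l ^ 2 := by nlinarith
          nlinarith
      _ = v * y := hvy.symm
      _ ≤ _ := by gcongr
  set Q : ℕ := ⌈γ / s⌉₊ with hQ
  have hQ1 : γ / s ≤ Q := Nat.le_ceil _
  clear_value Q
  have hgs : γ / s = 8 * l / α := by rw [hs, hε]; field_simp
  have hQ2 : (2 * Q + 1 : ℝ) ≤ 40 * l / α := by
    have := Nat.ceil_lt_add_one (a := γ / s) (by positivity)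
    rw [← hQ] at this
    have h1 : 1 ≤ 8 * l / α := by rw [le_div_iff₀ hα]; nlinarith
    have h2 : 40 * l / α = 5 * (8 * l / α) := by ring
    rw [hgs] at this
    linarith
  have hmain := cover_main X m xs H hH d hd0 hd γ s ε hγ hs0 j k Q (by rw [hvs]; exact hkv) hjk
    (by
      calc (2 * j + 1) * s ≤ (8 * l) * s := by gcongr
        _ = ε := by rw [hs]; field_simp) hQ1
  refine hmain.trans (ENNReal.ofReal_le_ofReal ?_)
  have hcb := count_bound (ι := Fin m) k (2 * Q + 1) (by positivity) hk0 (by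
    rw [Fintype.card_fin]
    have : (0:ℝ) ≤ Q := by positivity
    nlinarith)
  rw [Fintype.card_fin] at hcb
  have hbase : Real.exp 1 * (m * (2 * Q + 1 : ℝ) / k) ≤ Real.exp (4 * L) := by
    have h1 : (m * (2 * Q + 1 : ℝ) / k) ≤ 5 * y := by
      calc (m * (2 * Q + 1 : ℝ) / k) ≤ m * (40 * l / α) / v := by gcongr
        _ = 5 * y / l := by
          rw [hv, hy, hε]; field_simp; norm_num
        _ ≤ 5 * y := div_le_self (by positivity) hl1
    have h2 : (5:ℝ) ≤ Real.exp 2 := by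
      have := Real.exp_one_gt_d9
      have e3 : Real.exp 2 = Real.exp 1 ^ 2 := by rw [← Real.exp_nat_mul]; norm_num
      rw [e3]; nlinarith
    calc _ ≤ Real.exp 1 * (Real.exp 2 * Real.exp L) := by gcongr; exact h1.trans (by gcongr)
      _ = Real.exp (3 + L) := by rw [← Real.exp_add, ← Real.exp_add]; ring_nf
      _ ≤ _ := by rw [Real.exp_le_exp]; linarith
  have hsumle := hcb.trans (pow_le_pow_left₀ (by positivity) hbase k)
  calc _ ≤ ((Real.exp (4 * L)) ^ k) ^ 3 := by
        apply pow_le_pow_left₀ _ hsumle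
        exact sum_nonneg (fun _ _ => by positivity)
    _ = Real.exp (12 * (k * L)) := by
        rw [← Real.exp_nat_mul, ← Real.exp_nat_mul]; congr 1; push_cast; ring
    _ ≤ Real.exp (12 * ((2 * v) * L)) := by gcongr
    _ = _ := by
        congr 1
        rw [hv, hε, func, ← hL, ← hl]
        field_simp
        norm_num

end Helpers6

/-- Corollary `coverfinal`. -/
theorem stmt_3 :
    ∃ c c' : ℝ, 0 < c ∧ c ≤ c' ∧ 1 ≤ c' ∧
      ∀ (X : Type) (m : ℕ) (xs : Fin m → X) (H : Set (X → ℝ)) (d : ℕ),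
        (∀ h ∈ H, ∀ x, h x = 1 ∨ h x = -1) →
        HasVCDim H d →
        ∀ (α γ : ℝ), 0 < α → α < 1 / 2 → 0 < γ → γ ≤ 1 →
          γ ^ 2 ≥ 4 * c * d * (Ln (Ln (8 * α * m * γ ^ 2 / (c * d)))) ^ 2 / (α ^ 2 * m) →
          coveringNumber xs (clipClass (votingClassifiers H) γ) (α * γ) ≤
            ENNReal.ofReal (Real.exp ((c' * d / (α ^ 2 * γ ^ 2)) *
              func (8 * α * m * γ ^ 2 / (c * d)))) := by
  refine ⟨12390400, 24 * 12390400, by norm_num, by norm_num, by norm_num, ?_⟩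
  intro X m xs H d hH hVC α γ hα hα2 hγ hγ1 hyp
  have hone : (1 : ℝ≥0∞) ≤ ENNReal.ofReal (Real.exp ((24 * 12390400 * d / (α ^ 2 * γ ^ 2)) *
      func (8 * α * m * γ ^ 2 / (12390400 * d)))) := by
    rw [ENNReal.one_le_ofReal, Real.one_le_exp_iff]
    have h1 := one_le_Ln (8 * α * m * γ ^ 2 / (12390400 * d))
    unfold func
    positivity
  rcases Nat.eq_zero_or_pos m with hm | hm
  · subst hm
    exact (cover_one xs _ _ 0 (fun f _ i => i.elim0)).trans hone
  rcases Nat.eq_zero_or_pos d with hd0 | hd0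
  · obtain ⟨⟨s, hs, -⟩, hd⟩ := hVC
    obtain ⟨h0, hh0, -⟩ := hs (fun _ => 1) (fun _ => Or.inl rfl)
    have hall : ∀ h ∈ H, ∀ x, h x = h0 x := by
      intro h hh x
      by_contra hne
      have := hd {x} (by
        intro b hb
        by_cases hbx : h x = b x
        · exact ⟨h, hh, by simpa using hbx⟩
        · refine ⟨h0, hh0, ?_⟩
          intro z hz
          rw [Finset.mem_singleton] at hz
          subst hz
          rcases hb z with h1 | h1 <;> rcases hH h hh z with h2 | h2 <;>
            rcases hH h0 hh0 z with h3 | h3 <;> simp_all)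
      rw [Finset.card_singleton] at this
      omega
    refine (cover_one xs _ _ (clip γ h0) ?_).trans hone
    rintro _ ⟨f, ⟨n, a, h, hh, -, hsum, rfl⟩, rfl⟩ i
    have : (fun x => ∑ i, a i * h i x) = h0 := by
      funext x
      simp_rw [fun i => hall (h i) (hh i) x]
      rw [← Finset.sum_mul, hsum, one_mul]
    rw [this, sub_self, abs_zero]
    positivity
  · exact cover_pos X m xs H hH d hd0 hVC.2 α γ _ hα hα2 hγ hγ1 hm rfl hyp
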